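/- (Erdős–Sands–Sauer–Woodrow conjecture) Let k ≥ 1 and let T be a finite tournament on vertex set V (for every pair of distinct vertices exactly one of the arcs (x,y), (y,x) is present) whose arcs are coloured with k colours. Then there exists a set S ⊆ V with |S| ≤ k^{k+1} · (⌊ln(1/(2k))/ln(1 - 1/(2k))⌋ + 1) such that for every vertex v ∈ V there is a monochromatic directed path from some vertex of S to v (a vertex of S itself counts as a path of length zero). -/

import Mathlib

/-- `g(ε) = ⌊ln(ε)/ln(1-ε)⌋ + 1`. -/
noncomputable def gfun (ε : ℝ) : ℕ :=
  Nat.floor (Real.log ε / Real.log (1 - ε)) + 1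

open Finset in
/-- A skew-symmetric matrix game has value zero: some mixed strategy guarantees a nonnegative
payoff against every pure strategy. -/
theorem exists_stdSimplex_sum_mul_nonneg {α : Type*} [Fintype α] [Nonempty α]
    (M : α → α → ℝ) (hM : ∀ u v, M u v = -M v u) :
    ∃ w ∈ stdSimplex ℝ α, ∀ v, 0 ≤ ∑ u, w u * M u v := by
  classical
  by_contra! hcon
  let L : (α → ℝ) →ₗ[ℝ] (α → ℝ) := Matrix.vecMulLinear (Matrix.of M)
  have hL : ∀ w v, L w v = ∑ u, w u * M u v := fun w v => by
    simp [L, Matrix.vecMul, dotProduct]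
  have hdisj : Disjoint (L '' stdSimplex ℝ α) (Set.Ici 0) := by
    rw [Set.disjoint_left]
    rintro _ ⟨w, hw, rfl⟩ hnonneg
    obtain ⟨v, hv⟩ := hcon w hw
    exact absurd (hnonneg v) (by simpa [hL] using hv)
  obtain ⟨f, s, t, hs, hst, ht⟩ := geometric_hahn_banach_compact_closed
    ((convex_stdSimplex ℝ α).linear_image L)
    ((isCompact_stdSimplex ℝ α).image L.continuous_of_finiteDimensional)
    (convex_Ici (0 : α → ℝ)) isClosed_Ici hdisj
  have ht0 : t < 0 := by simpa using ht 0 (by simp)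
  have hf : ∀ z : α → ℝ, f z = ∑ v, z v * f (Pi.single v 1) := fun z => by
    conv_lhs => rw [pi_eq_sum_univ' z]
    simp only [map_sum, map_smul, smul_eq_mul]
  set p : α → ℝ := fun v => f (Pi.single v 1)
  have hp0 : ∀ v, 0 ≤ p v := fun v => by
    by_contra! hneg
    have h := ht ((t / p v) • Pi.single v 1) <| Set.mem_Ici.2 <|
      smul_nonneg (div_nonneg_of_nonpos ht0.le hneg.le) (Pi.single_nonneg.2 zero_le_one)
    rw [map_smul, smul_eq_mul] at h
    change t < t / p v * p v at h
    rw [div_mul_cancel₀ _ hneg.ne] at h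
    exact lt_irrefl _ h
  have hquad : f (L p) = 0 := by
    have h1 : f (L p) = ∑ v, ∑ u, p u * M u v * p v := by
      rw [hf]; exact sum_congr rfl fun v _ => by rw [hL, sum_mul]
    have h2 : f (L p) = -f (L p) := by
      conv_lhs => rw [h1, sum_comm]
      rw [h1, ← sum_neg_distrib]
      refine sum_congr rfl fun v _ => ?_
      rw [← sum_neg_distrib]
      exact sum_congr rfl fun u _ => by rw [hM v u]; ring
    linarith
  rcases (sum_nonneg fun v (_ : v ∈ univ) => hp0 v).eq_or_lt with hsum | hsum
  · have hpz : ∀ v, p v = 0 := fun v =>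
      (sum_eq_zero_iff_of_nonneg fun v _ => hp0 v).1 hsum.symm v (mem_univ v)
    have h := hs _ ⟨_, single_mem_stdSimplex ℝ (Classical.arbitrary α), rfl⟩
    have hz : ∀ z, f z = 0 := fun z => by
      rw [hf]; exact sum_eq_zero fun v _ => mul_eq_zero_of_right _ (hpz v)
    rw [hz] at h
    linarith
  · have h := hs _ ⟨(∑ v, p v)⁻¹ • p, ⟨fun v => mul_nonneg (inv_nonneg.2 hsum.le) (hp0 v), by
      simp [← mul_sum, inv_mul_cancel₀ hsum.ne']⟩, rfl⟩
    rw [map_smul, map_smul, hquad, smul_zero] at h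
    linarith

open Finset Classical in
/-- For a total relation `E` on a nonempty finite set `X` there is a probability distribution on
`X` for which every closed in-neighbourhood has weight at least `1/2`. -/
theorem exists_stdSimplex_half_le_inNeighborhood {V : Type*} [Fintype V] (E : V → V → Prop)
    (hE : ∀ x y, E x y ∨ E y x) (X : Finset V) (hX : X.Nonempty) :
    ∃ w ∈ stdSimplex ℝ V, (∀ u ∉ X, w u = 0) ∧ ∀ v ∈ X, 1 / 2 ≤ ∑ u with E u v, w u := by
  have : Nonempty X := hX.to_subtype
  obtain ⟨w, ⟨hw0, hw1⟩, hw⟩ := exists_stdSimplex_sum_mul_nonneg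
    (fun u v : X => (if E u v then (1 : ℝ) else 0) - if E v u then 1 else 0) fun u v => by ring
  let w' : V → ℝ := fun u => if h : u ∈ X then w ⟨u, h⟩ else 0
  have hsum : ∀ φ : V → ℝ, ∑ u, w' u * φ u = ∑ u : X, w u * φ u := fun φ => by
    rw [← sum_subset (subset_univ X) fun u _ hu => by simp [w', hu], ← sum_coe_sort X]
    exact sum_congr rfl fun u _ => by simp [w']
  have hw'0 : ∀ u, 0 ≤ w' u := fun u => by
    by_cases hu : u ∈ X <;> simp [w', hu, hw0]
  have hw'1 : ∑ u, w' u = 1 := by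
    simpa only [mul_one, hw1] using hsum fun _ => 1
  refine ⟨w', ⟨hw'0, hw'1⟩, fun u hu => by simp [w', hu], fun v hv => ?_⟩
  have h := hw ⟨v, hv⟩
  rw [← hsum fun u => (if E u v then (1 : ℝ) else 0) - if E v u then 1 else 0] at h
  simp only [mul_sub, mul_ite, mul_one, mul_zero, sum_sub_distrib, ← sum_filter] at h
  have hcover : 1 ≤ (∑ u with E u v, w' u) + ∑ u with E v u, w' u := by
    rw [← hw'1, sum_filter, sum_filter, ← sum_add_distrib]
    refine sum_le_sum fun u _ => ?_
    rcases hE u v with huv | huv <;> simp only [huv, if_true] <;> split_ifs <;>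
      linarith [hw'0 u]
  linarith

open Finset Classical in
/-- If every point charged by `μ` has an in-neighbourhood of `w`-weight at least `ε`, then some
`n` points leave at most a fraction `(1 - ε) ^ n` of `μ` undominated. -/
theorem exists_card_le_sum_undominated_le {V : Type*} [Fintype V] (R : V → V → Prop)
    {ε : ℝ} (hε : ε ≤ 1) {w μ : V → ℝ} (hw : w ∈ stdSimplex ℝ V) (hμ : ∀ y, 0 ≤ μ y)
    (h : ∀ y, μ y ≠ 0 → ε ≤ ∑ u with R u y, w u) (n : ℕ) :
    ∃ S : Finset V, #S ≤ n ∧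
      ∑ y with ¬∃ s ∈ S, R s y, μ y ≤ (1 - ε) ^ n * ∑ y, μ y := by
  induction n with
  | zero => exact ⟨∅, by simp⟩
  | succ n ih =>
    obtain ⟨S, hS, hle⟩ := ih
    set U : Finset V := {y | ¬∃ s ∈ S, R s y} with hU
    have havg : ∑ s, w s * ∑ y ∈ U with ¬R s y, μ y ≤ ∑ s, w s * ((1 - ε) * ∑ y ∈ U, μ y) := by
      rw [← sum_mul, hw.2, one_mul]
      simp only [sum_filter, mul_sum]
      rw [sum_comm]
      refine sum_le_sum fun y _ => ?_
      by_cases hy : μ y = 0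
      · simp [hy]
      have hsplit := sum_filter_add_sum_filter_not univ (fun s => R s y) w
      rw [hw.2] at hsplit
      calc ∑ s, w s * (if ¬R s y then μ y else 0)
          = (∑ s with ¬R s y, w s) * μ y := by
            rw [sum_mul, sum_filter]; exact sum_congr rfl fun s _ => by split_ifs <;> simp
        _ ≤ (1 - ε) * μ y := by
            gcongr
            · exact hμ y
            · linarith [h y hy]
    obtain ⟨s, hs⟩ : ∃ s, ∑ y ∈ U with ¬R s y, μ y ≤ (1 - ε) * ∑ y ∈ U, μ y := by
      by_contra! hlt
      refine havg.not_gt (sum_lt_sum (fun s _ => mul_le_mul_of_nonneg_left (hlt s).le (hw.1 s)) ?_)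
      obtain ⟨s, -, hs⟩ := exists_ne_zero_of_sum_ne_zero (hw.2.trans_ne one_ne_zero)
      exact ⟨s, mem_univ s, mul_lt_mul_of_pos_left (hlt s) ((hw.1 s).lt_of_ne' hs)⟩
    refine ⟨insert s S, (card_insert_le _ _).trans (by omega), ?_⟩
    have hset : ({y | ¬∃ t ∈ insert s S, R t y} : Finset V) = {y ∈ U | ¬R s y} := by
      ext y
      simp only [hU, mem_filter, mem_univ, true_and, exists_mem_insert, not_or]
      exact and_comm
    rw [hset]
    calc _ ≤ _ := hs
      _ ≤ (1 - ε) * ((1 - ε) ^ n * ∑ y, μ y) :=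
        mul_le_mul_of_nonneg_left hle (by linarith)
      _ = _ := by ring

open Finset Classical in
/-- For a transitive relation, if every point charged by `μ` has an in-neighbourhood of
`w`-weight at least `ε`, then few points dominate all those whose in-neighbourhood has
`μ`-weight at least `ε`. -/
theorem exists_card_le_dominating_of_trans {V : Type*} [Fintype V] (R : V → V → Prop)
    (hR : ∀ x y z, R x y → R y z → R x z) {ε : ℝ} (hε : ε ≤ 1) {n : ℕ} (hn : (1 - ε) ^ n < ε)
    {w μ : V → ℝ} (hw : w ∈ stdSimplex ℝ V) (hμ : μ ∈ stdSimplex ℝ V)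
    (h : ∀ y, μ y ≠ 0 → ε ≤ ∑ u with R u y, w u) :
    ∃ S : Finset V, #S ≤ n ∧ ∀ x, ε ≤ ∑ u with R u x, μ u → ∃ s ∈ S, R s x := by
  obtain ⟨S, hS, hle⟩ := exists_card_le_sum_undominated_le R hε hw hμ.1 h n
  rw [hμ.2, mul_one] at hle
  refine ⟨S, hS, fun x hx => ?_⟩
  by_contra hcon
  refine (hle.trans_lt hn).not_ge (hx.trans (sum_le_sum_of_subset_of_nonneg ?_ fun y _ _ => hμ.1 y))
  intro u hu
  simp only [mem_filter, mem_univ, true_and] at hu ⊢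
  exact fun ⟨s, hs, hsu⟩ => hcon ⟨s, hs, hR _ _ _ hsu hu⟩

open Finset Classical in
/-- Domination of a set `X` by a union of `k` transitive relations, when for each colour in `C`
a distribution is known giving weight at least `1/(2k)` to all in-neighbourhoods of points
of `X`. -/
theorem exists_card_le_dominating_of_colours {V : Type*} [Fintype V] {k : ℕ}
    (R : Fin k → V → V → Prop) (htrans : ∀ i x y z, R i x y → R i y z → R i x z)
    (htotal : ∀ x y, (∃ i, R i x y) ∨ ∃ i, R i y x) (hk : 1 ≤ k) {n : ℕ}
    (hn : (1 - 1 / (2 * (k : ℝ))) ^ n < 1 / (2 * (k : ℝ))) (m : ℕ) :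
    ∀ (C : Finset (Fin k)) (X : Finset V), k ≤ #C + m →
      (∀ i ∈ C, ∃ w ∈ stdSimplex ℝ V,
        ∀ y ∈ X, 1 / (2 * (k : ℝ)) ≤ ∑ u with R i u y, w u) →
      ∃ S : Finset V, #S ≤ k ^ (m + 1) * n ∧ ∀ v ∈ X, ∃ s ∈ S, ∃ i, R i s v := by
  have hk' : (1 : ℝ) ≤ k := by exact_mod_cast hk
  have hε : 1 / (2 * (k : ℝ)) ≤ 1 := by
    rw [div_le_one (by positivity)]; linarith
  have hε0 : (0 : ℝ) < 1 / (2 * (k : ℝ)) := by positivity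
  induction m using Nat.strong_induction_on with
  | _ m ih =>
  intro C X hC hw
  obtain rfl | hX := X.eq_empty_or_nonempty
  · exact ⟨∅, by simp⟩
  obtain ⟨μ, hμ, hμX, hhalf⟩ := exists_stdSimplex_half_le_inNeighborhood
    (fun x y => ∃ i, R i x y) htotal X hX
  have hcolour : ∀ v ∈ X, ∃ j, 1 / (2 * (k : ℝ)) ≤ ∑ u with R j u v, μ u := by
    intro v hv
    by_contra! hlt
    have hlt' : ∑ j, ∑ u with R j u v, μ u < ∑ _j : Fin k, 1 / (2 * (k : ℝ)) :=
      sum_lt_sum_of_nonempty ⟨⟨0, hk⟩, mem_univ _⟩ fun j _ => hlt j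
    have hhalf' : ∑ _j : Fin k, 1 / (2 * (k : ℝ)) = 1 / 2 := by
      simp only [sum_const, card_univ, Fintype.card_fin, nsmul_eq_mul]; field_simp
    have hunion : ∑ u with ∃ i, R i u v, μ u ≤ ∑ j, ∑ u with R j u v, μ u := by
      simp only [sum_filter]
      rw [sum_comm]
      refine sum_le_sum fun u _ => ?_
      have hnonneg : ∀ j ∈ univ, 0 ≤ if R j u v then μ u else 0 := fun j _ => by
        split_ifs <;> simp [hμ.1 u]
      split_ifs with hi
      · obtain ⟨i, hi⟩ := hi
        simpa [hi] using single_le_sum hnonneg (mem_univ i)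
      · exact sum_nonneg hnonneg
    have hle : 1 / 2 ≤ ∑ j, ∑ u with R j u v, μ u :=
      (hhalf v hv).trans (le_of_eq_of_le (by congr) hunion)
    linarith
  have hclass : ∀ j, ∃ S : Finset V, #S ≤ k ^ m * n ∧
      ∀ v ∈ X, 1 / (2 * (k : ℝ)) ≤ ∑ u with R j u v, μ u → ∃ s ∈ S, ∃ i, R i s v := by
    intro j
    by_cases hj : j ∈ C
    · obtain ⟨w, hw, hwX⟩ := hw j hj
      obtain ⟨S, hS, hdom⟩ := exists_card_le_dominating_of_trans (R j) (htrans j) hε hn hw hμ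
        fun y hy => hwX y (not_imp_comm.1 (hμX y) hy)
      refine ⟨S, hS.trans (Nat.le_mul_of_pos_left n (by positivity)), fun v _ hv => ?_⟩
      obtain ⟨s, hs, hsv⟩ := hdom v hv
      exact ⟨s, hs, j, hsv⟩
    · have hcard := card_le_univ (insert j C)
      rw [card_insert_of_notMem hj, Fintype.card_fin] at hcard
      obtain ⟨m, rfl⟩ : ∃ l, m = l + 1 := ⟨m - 1, by omega⟩
      obtain ⟨S, hS, hdom⟩ := ih m m.lt_succ_self (insert j C)
        {v ∈ X | 1 / (2 * (k : ℝ)) ≤ ∑ u with R j u v, μ u}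
        (by rw [card_insert_of_notMem hj]; omega) fun i hi => by
          obtain rfl | hi := mem_insert.1 hi
          · exact ⟨μ, hμ, fun y hy => (mem_filter.1 hy).2⟩
          · obtain ⟨w, hw, hwX⟩ := hw i hi
            exact ⟨w, hw, fun y hy => hwX y (mem_filter.1 hy).1⟩
      exact ⟨S, hS, fun v hv hvj => hdom v (mem_filter.2 ⟨hv, hvj⟩)⟩
  choose S hS hdom using hclass
  refine ⟨univ.biUnion S, ?_, fun v hv => ?_⟩
  · refine (card_biUnion_le_card_mul _ _ _ fun j _ => hS j).trans_eq ?_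
    rw [card_univ, Fintype.card_fin]; ring
  · obtain ⟨j, hj⟩ := hcolour v hv
    obtain ⟨s, hs, hsv⟩ := hdom j v hv hj
    exact ⟨s, mem_biUnion.2 ⟨j, mem_univ j, hs⟩, hsv⟩

theorem one_sub_pow_gfun_lt {ε : ℝ} (h0 : 0 < ε) (h1 : ε < 1) : (1 - ε) ^ gfun ε < ε := by
  have hlog : Real.log (1 - ε) < 0 := Real.log_neg (by linarith) (by linarith)
  rw [← Real.log_lt_log_iff (by have := sub_pos.2 h1; positivity) h0, Real.log_pow,
    ← div_lt_iff_of_neg hlog, gfun, Nat.cast_add, Nat.cast_one]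
  exact Nat.lt_floor_add_one _

/-- Erdős–Sands–Sauer–Woodrow conjecture: let `k ≥ 1` and let `T` be a finite tournament on
`V` (for distinct `x, y` exactly one of the arcs `(x,y)`, `(y,x)` is present, and there are
no loops) whose arcs are coloured with `k` colours by `c`. Then there is a set `S ⊆ V` with
`|S| ≤ k^(k+1) · g(1/(2k))` such that every vertex `v` is reachable from some vertex of `S`
by a monochromatic directed path (possibly of length zero). -/
theorem erdos_sands_sauer_woodrow
    {V : Type*} [Fintype V] {k : ℕ} (hk : 1 ≤ k)
    (A : V → V → Prop)
    (hirrefl : ∀ x, ¬ A x x)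
    (htourn : ∀ x y : V, x ≠ y → (A x y ↔ ¬ A y x))
    (c : V → V → Fin k) :
    ∃ S : Finset V,
      S.card ≤ k ^ (k + 1) * gfun (1 / (2 * (k : ℝ))) ∧
      ∀ v : V, ∃ s ∈ S, ∃ i : Fin k,
        Relation.ReflTransGen (fun a b => A a b ∧ c a b = i) s v := by
  have hk' : (1 : ℝ) ≤ k := by exact_mod_cast hk
  have htotal : ∀ x y : V,
      (∃ i, Relation.ReflTransGen (fun a b => A a b ∧ c a b = i) x y) ∨
        ∃ i, Relation.ReflTransGen (fun a b => A a b ∧ c a b = i) y x := by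
    intro x y
    obtain rfl | hxy := eq_or_ne x y
    · exact Or.inl ⟨⟨0, hk⟩, .refl⟩
    by_cases h : A x y
    · exact Or.inl ⟨c x y, .single ⟨h, rfl⟩⟩
    · exact Or.inr ⟨c y x, .single ⟨(htourn y x hxy.symm).2 h, rfl⟩⟩
  obtain ⟨S, hS, hdom⟩ := exists_card_le_dominating_of_colours
    (fun i => Relation.ReflTransGen fun a b => A a b ∧ c a b = i)
    (fun _ _ _ _ => Relation.ReflTransGen.trans) htotal hk
    (one_sub_pow_gfun_lt (by positivity) (by rw [div_lt_one (by positivity)]; linarith)) k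
    ∅ Finset.univ (by simp) (by simp)
  exact ⟨S, hS, fun v => hdom v (Finset.mem_univ v)⟩
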